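/- arXiv:1304.6102 — 2 statements merged into one kernel-verified Lean document; each statement's English description precedes it below -/
import Mathlib

section
/- Let a < b be real numbers, let d ≥ 1 be an integer, let ε > 0 and λ > 0. Let φ : [a,b] → ℝ be d-times differentiable with |φ^{(d)}(t)| ≥ ε for all t ∈ [a,b]; if d = 1, additionally assume that φ is twice differentiable and that φ' is monotonic on [a,b]. Then |∫_a^b e^{iλφ(t)} dt| ≤ c_d/(λε)^{1/d}, where c_d = 5·2^{d−1} − 2; in particular the bound is independent of a and b. -/
open MeasureTheory Set

/-- The oscillating integrand is unimodular. -/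
lemma vdc_norm (lam x : ℝ) : ‖Complex.exp (Complex.I * (lam : ℂ) * (x : ℂ))‖ = 1 := by
  have : Complex.I * (lam : ℂ) * (x : ℂ) = ((lam * x : ℝ) : ℂ) * Complex.I := by
    push_cast; ring
  rw [this, Complex.norm_exp_ofReal_mul_I]

/-- A nonvanishing continuous function has the same sign everywhere. -/
lemma vdc_sign {a b : ℝ} {g : ℝ → ℝ} (hg : ContinuousOn g (Icc a b))
    (h0 : ∀ t ∈ Icc a b, g t ≠ 0) {s t : ℝ} (hs : s ∈ Icc a b) (ht : t ∈ Icc a b)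
    (hpos : 0 < g s) : 0 < g t := by
  by_contra hcon
  have hoc := isPreconnected_Icc.intermediate_value ht hs hg
  obtain ⟨z, hz, hz0⟩ := hoc ⟨not_lt.1 hcon, hpos.le⟩
  exact h0 z hz hz0

lemma vdc_inv_sub {a b ε : ℝ} (hab : a < b) (hε : 0 < ε) {g : ℝ → ℝ}
    (hg : ContinuousOn g (Icc a b)) (h : ∀ t ∈ Icc a b, ε ≤ |g t|) :
    |(g b)⁻¹ - (g a)⁻¹| ≤ 1 / ε := by
  have h0 : ∀ t ∈ Icc a b, g t ≠ 0 := fun t ht h1 => by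
    have := h t ht
    rw [h1, abs_zero] at this; linarith
  have ha : a ∈ Icc a b := left_mem_Icc.2 hab.le
  have hb : b ∈ Icc a b := right_mem_Icc.2 hab.le
  have key : ∀ x y : ℝ, 0 < x → 0 < y → ε ≤ x → ε ≤ y → |y⁻¹ - x⁻¹| ≤ 1 / ε := by
    intro x y hx hy hex hey
    have h1 : x⁻¹ ≤ 1 / ε := by rw [one_div]; exact inv_anti₀ hε hex
    have h2 : y⁻¹ ≤ 1 / ε := by rw [one_div]; exact inv_anti₀ hε hey
    have h3 : 0 < x⁻¹ := inv_pos.2 hx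
    have h4 : 0 < y⁻¹ := inv_pos.2 hy
    rw [abs_le]; constructor <;> linarith
  rcases lt_or_gt_of_ne (h0 a ha) with hn | hp
  · have hn' : 0 < (fun t => - g t) b :=
      vdc_sign (g := fun t => - g t) hg.neg (fun t ht => neg_ne_zero.2 (h0 t ht)) ha hb
        (neg_pos.2 hn)
    have hn2 : 0 < - g b := hn'
    have e1 := h a ha
    have e2 := h b hb
    rw [abs_of_neg hn] at e1
    rw [abs_of_neg (by linarith)] at e2
    have := key (- g a) (- g b) (by linarith) hn2 e1 e2
    rw [inv_neg, inv_neg] at this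
    rw [abs_sub_comm]
    convert this using 2
    ring
  · have hp2 := vdc_sign hg h0 ha hb hp
    have e1 := h a ha
    have e2 := h b hb
    rw [abs_of_pos hp] at e1
    rw [abs_of_pos hp2] at e2
    exact key _ _ hp hp2 e1 e2

/-- The case `d = 1`. -/
lemma vdc_base {a b ε lam : ℝ} (hab : a < b) (hε : 0 < ε) (hlam : 0 < lam) {f g h : ℝ → ℝ}
    (hf : ∀ t ∈ Icc a b, HasDerivWithinAt f (g t) (Icc a b) t)
    (hg : ∀ t ∈ Icc a b, HasDerivWithinAt g (h t) (Icc a b) t)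
    (hge : ∀ t ∈ Icc a b, ε ≤ |g t|)
    (hm : MonotoneOn g (Icc a b) ∨ AntitoneOn g (Icc a b)) :
    ‖∫ t in a..b, Complex.exp (Complex.I * (lam : ℂ) * (f t : ℂ))‖ ≤ 3 / (lam * ε) := by
  have h0 : ∀ t ∈ Icc a b, g t ≠ 0 := fun t ht h1 => by
    have := hge t ht
    rw [h1, abs_zero] at this; linarith
  have ha : a ∈ Icc a b := left_mem_Icc.2 hab.le
  have hb : b ∈ Icc a b := right_mem_Icc.2 hab.le
  have hfc : ContinuousOn f (Icc a b) := fun t ht => (hf t ht).continuousWithinAt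
  have hgc : ContinuousOn g (Icc a b) := fun t ht => (hg t ht).continuousWithinAt
  have huc : ContinuousOn (fun t => (g t)⁻¹) (Icc a b) := hgc.inv₀ h0
  set v : ℝ → ℂ := fun t => Complex.exp (Complex.I * (lam : ℂ) * (f t : ℂ)) with hv
  have hvc : ContinuousOn v (Icc a b) := by
    have : ContinuousOn (fun t => (f t : ℂ)) (Icc a b) :=
      Complex.continuous_ofReal.comp_continuousOn hfc
    exact Complex.continuous_exp.comp_continuousOn (continuousOn_const.mul this)
  set w : ℝ → ℝ := fun t => - h t / g t ^ 2 with hw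
  have hud : ∀ t ∈ Ioo a b, HasDerivAt (fun t => (g t)⁻¹) (w t) t := fun t ht =>
    ((hg t (Ioo_subset_Icc_self ht)).hasDerivAt (Icc_mem_nhds ht.1 ht.2)).fun_inv
      (h0 t (Ioo_subset_Icc_self ht))
  have hvd : ∀ t ∈ Ioo a b,
      HasDerivAt v (Complex.I * (lam : ℂ) * (g t : ℂ) * v t) t := fun t ht => by
    have h1 := ((hf t (Ioo_subset_Icc_self ht)).hasDerivAt (Icc_mem_nhds ht.1 ht.2)).ofReal_comp
    have h2 := (h1.const_mul (Complex.I * (lam : ℂ))).cexp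
    convert h2 using 1
    rw [hv]; ring
  have hcase : (∀ t ∈ Icc a b, 0 ≤ w t) ∨ (∀ t ∈ Icc a b, w t ≤ 0) := by
    rcases hm with hm | hm
    · right
      intro t ht
      have := hm.derivWithin_nonneg (x := t)
      rw [(hg t ht).derivWithin (uniqueDiffOn_Icc hab t ht)] at this
      exact div_nonpos_of_nonpos_of_nonneg (by linarith) (sq_nonneg _)
    · left
      intro t ht
      have := hm.derivWithin_nonpos (x := t)
      rw [(hg t ht).derivWithin (uniqueDiffOn_Icc hab t ht)] at this
      exact div_nonneg (by linarith) (sq_nonneg _)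
  have hwi : IntervalIntegrable w volume a b := by
    rw [intervalIntegrable_iff_integrableOn_Ioc_of_le hab.le]
    rcases hcase with hc | hc
    · exact intervalIntegral.integrableOn_deriv_of_nonneg huc hud
        (fun t ht => hc t (Ioo_subset_Icc_self ht))
    · have := intervalIntegral.integrableOn_deriv_of_nonneg huc.neg
        (fun t ht => (hud t ht).neg)
        (fun t ht => neg_nonneg.2 (hc t (Ioo_subset_Icc_self ht)))
      simpa using this.neg
  have hFTC : ∫ t in a..b, w t = (g b)⁻¹ - (g a)⁻¹ :=
    intervalIntegral.integral_eq_sub_of_hasDeriv_right_of_le hab.le huc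
      (fun t ht => (hud t ht).hasDerivWithinAt) hwi
  have habs : ∫ t in a..b, |w t| ≤ 1 / ε := by
    refine le_trans ?_ (vdc_inv_sub hab hε hgc hge)
    rw [← hFTC]
    rcases hcase with hc | hc
    · rw [intervalIntegral.integral_congr (g := w)]
      · exact le_abs_self _
      · intro t ht
        rw [uIcc_of_le hab.le] at ht
        exact abs_of_nonneg (hc t ht)
    · rw [intervalIntegral.integral_congr (g := fun t => - w t)]
      · rw [intervalIntegral.integral_neg]; exact neg_le_abs _
      · intro t ht
        rw [uIcc_of_le hab.le] at ht
        exact abs_of_nonpos (hc t ht)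
  have hparts := intervalIntegral.integral_mul_deriv_eq_deriv_mul_of_hasDeriv_right
    (a := a) (b := b) (u := fun t => (((g t)⁻¹ : ℝ) : ℂ)) (v := v)
    (u' := fun t => ((w t : ℝ) : ℂ)) (v' := fun t => Complex.I * (lam : ℂ) * (g t : ℂ) * v t)
    (by rw [uIcc_of_le hab.le]; exact Complex.continuous_ofReal.comp_continuousOn huc)
    (by rw [uIcc_of_le hab.le]; exact hvc)
    (by
      rw [min_eq_left hab.le, max_eq_right hab.le]
      exact fun t ht => (hud t ht).ofReal_comp.hasDerivWithinAt)
    (by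
      rw [min_eq_left hab.le, max_eq_right hab.le]
      exact fun t ht => (hvd t ht).hasDerivWithinAt)
    ⟨hwi.1.ofReal, hwi.2.ofReal⟩
    (by
      apply ContinuousOn.intervalIntegrable
      rw [uIcc_of_le hab.le]
      exact (continuousOn_const.mul (Complex.continuous_ofReal.comp_continuousOn hgc)).mul hvc)
  have hleft : ∫ t in a..b, (((g t)⁻¹ : ℝ) : ℂ) * (Complex.I * (lam : ℂ) * (g t : ℂ) * v t)
      = Complex.I * (lam : ℂ) * ∫ t in a..b, v t := by
    rw [← intervalIntegral.integral_const_mul]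
    apply intervalIntegral.integral_congr
    intro t ht
    rw [uIcc_of_le hab.le] at ht
    have : (g t : ℂ) ≠ 0 := by exact_mod_cast h0 t ht
    push_cast
    field_simp
  rw [hleft] at hparts
  have hvn : ∀ t, ‖v t‖ = 1 := fun t => vdc_norm lam (f t)
  have hbd : ∀ t ∈ Icc a b, ‖(((g t)⁻¹ : ℝ) : ℂ) * v t‖ ≤ 1 / ε := by
    intro t ht
    rw [norm_mul, hvn, mul_one, Complex.norm_real, Real.norm_eq_abs, abs_inv, one_div]
    exact inv_anti₀ hε (hge t ht)
  have hint : ‖∫ t in a..b, (w t : ℂ) * v t‖ ≤ 1 / ε := by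
    refine (intervalIntegral.norm_integral_le_integral_norm hab.le).trans ?_
    simpa [hvn] using habs
  have htot : lam * ‖∫ t in a..b, v t‖ ≤ 3 / ε := by
    have h1 : lam * ‖∫ t in a..b, v t‖ = ‖Complex.I * (lam : ℂ) * ∫ t in a..b, v t‖ := by
      rw [norm_mul, norm_mul, Complex.norm_I, one_mul, Complex.norm_real, Real.norm_eq_abs,
        abs_of_pos hlam]
    rw [h1, hparts]
    have h2 := norm_sub_le ((((g b)⁻¹ : ℝ) : ℂ) * v b - (((g a)⁻¹ : ℝ) : ℂ) * v a)
      (∫ t in a..b, (w t : ℂ) * v t)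
    have h3 := norm_sub_le ((((g b)⁻¹ : ℝ) : ℂ) * v b) ((((g a)⁻¹ : ℝ) : ℂ) * v a)
    have h4 := hbd a ha
    have h5 := hbd b hb
    have h6 : 3 / ε = 1 / ε + 1 / ε + 1 / ε := by ring
    rw [h6]
    linarith
  rw [mul_comm lam ε, ← div_div, le_div_iff₀ hlam, mul_comm]
  exact htot

/-- Expansion estimate from the mean value theorem. -/
lemma vdc_expand {a b ε : ℝ} {f g : ℝ → ℝ}
    (hf : ∀ t ∈ Icc a b, HasDerivWithinAt f (g t) (Icc a b) t)
    (hge : ∀ t ∈ Icc a b, ε ≤ |g t|) {s t : ℝ} (hs : s ∈ Icc a b) (ht : t ∈ Icc a b) :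
    ε * |t - s| ≤ |f t - f s| := by
  have hfc : ContinuousOn f (Icc a b) := fun t ht => (hf t ht).continuousWithinAt
  have key : ∀ x ∈ Icc a b, ∀ y ∈ Icc a b, x < y → ε * |y - x| ≤ |f y - f x| := by
    intro x hx y hy hxy
    obtain ⟨c, hc, hce⟩ := exists_hasDerivAt_eq_slope f g hxy
      (hfc.mono (Icc_subset_Icc hx.1 hy.2))
      (fun z hz => (hf z ⟨hx.1.trans hz.1.le, hz.2.le.trans hy.2⟩).hasDerivAt
        (Icc_mem_nhds (hx.1.trans_lt hz.1) (hz.2.trans_le hy.2)))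
    have h1 : f y - f x = g c * (y - x) := by
      rw [hce, div_mul_cancel₀]; linarith
    rw [h1, abs_mul]
    exact mul_le_mul_of_nonneg_right (hge c ⟨hx.1.trans hc.1.le, hc.2.le.trans hy.2⟩)
      (abs_nonneg _)
  rcases lt_trichotomy s t with h | h | h
  · exact key s hs t ht h
  · simp [h]
  · rw [abs_sub_comm t s, abs_sub_comm (f t) (f s)]
    exact key t ht s hs h

/-- There is a point `c` such that `|f|` grows at least linearly away from `c`. -/
lemma vdc_center {a b ε : ℝ} (hab : a < b) {f g : ℝ → ℝ}
    (hf : ∀ t ∈ Icc a b, HasDerivWithinAt f (g t) (Icc a b) t)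
    (hge : ∀ t ∈ Icc a b, ε ≤ |g t|) :
    ∃ c ∈ Icc a b, ∀ t ∈ Icc a b, ε * |t - c| ≤ |f t| := by
  have hfc : ContinuousOn f (Icc a b) := fun t ht => (hf t ht).continuousWithinAt
  by_cases hz : ∃ c ∈ Icc a b, f c = 0
  · obtain ⟨c, hc, hc0⟩ := hz
    refine ⟨c, hc, fun t ht => ?_⟩
    simpa [hc0] using vdc_expand hf hge hc ht
  push Not at hz
  obtain ⟨c, hc, hmin⟩ := isCompact_Icc.exists_isMinOn (nonempty_Icc.2 hab.le) hfc.abs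
  refine ⟨c, hc, fun t ht => (vdc_expand hf hge hc ht).trans ?_⟩
  have hle : |f c| ≤ |f t| := hmin ht
  rcases lt_or_gt_of_ne (hz c hc) with hn | hp
  · have h1 : 0 < - f t :=
      vdc_sign (g := fun t => - f t) hfc.neg (fun t ht => neg_ne_zero.2 (hz t ht)) hc ht
        (neg_pos.2 hn)
    rw [abs_of_neg hn, abs_of_neg (by linarith : f t < 0)] at hle
    rw [abs_of_neg (by linarith : f t < 0), abs_of_nonpos (by linarith)]
    linarith
  · have h1 := vdc_sign hfc hz hc ht hp
    rw [abs_of_pos hp, abs_of_pos h1] at hle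
    rw [abs_of_pos h1, abs_of_nonneg (by linarith)]
    linarith

lemma vdc_rpow {x : ℝ} (hx : 0 < x) (n : ℕ) :
    (x * x ^ (-((1 : ℝ) / ((n + 1 : ℕ) + 1)))) ^ ((1 : ℝ) / (n + 1 : ℕ)) =
      (x ^ (-((1 : ℝ) / ((n + 1 : ℕ) + 1))))⁻¹ := by
  have h1 : x * x ^ (-((1 : ℝ) / ((n + 1 : ℕ) + 1))) =
      x ^ (1 + -((1 : ℝ) / ((n + 1 : ℕ) + 1))) := by
    rw [Real.rpow_add hx, Real.rpow_one]
  rw [h1, ← Real.rpow_mul hx.le, Real.rpow_neg hx.le, inv_inv]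
  congr 1
  push_cast
  field_simp
  ring

lemma vdc_main (lam : ℝ) (hlam : 0 < lam) (n : ℕ) :
    ∀ (a b ε : ℝ) (_ : a < b) (_ : 0 < ε) (Φ : ℕ → ℝ → ℝ)
    (_ : ∀ k < n + 1, ∀ t ∈ Set.Icc a b,
      HasDerivWithinAt (Φ k) (Φ (k + 1) t) (Set.Icc a b) t)
    (_ : ∀ t ∈ Set.Icc a b, ε ≤ |Φ (n + 1) t|)
    (_ : n = 0 →
      (∃ φ'' : ℝ → ℝ, ∀ t ∈ Set.Icc a b, HasDerivWithinAt (Φ 1) (φ'' t) (Set.Icc a b) t) ∧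
      (MonotoneOn (Φ 1) (Set.Icc a b) ∨ AntitoneOn (Φ 1) (Set.Icc a b))),
    ‖∫ t in a..b, Complex.exp (Complex.I * (lam : ℂ) * (Φ 0 t : ℂ))‖ ≤
      (5 * 2 ^ n - 2 : ℝ) / (lam * ε) ^ ((1 : ℝ) / (n + 1 : ℕ)) := by
  induction n with
  | zero =>
    intro a b ε hab hε Φ hΦ hΦε hd1
    obtain ⟨⟨h, hh⟩, hm⟩ := hd1 rfl
    have := vdc_base hab hε hlam (hΦ 0 (by norm_num)) hh hΦε hm
    norm_num
    exact this
  | succ n ih =>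
    intro a b ε hab hε Φ hΦ hΦε _
    have hder := hΦ (n + 1) (by omega)
    obtain ⟨c, hc, hcen⟩ := vdc_center hab hder hΦε
    have hx : 0 < lam * ε := mul_pos hlam hε
    set δ : ℝ := (lam * ε) ^ (-((1 : ℝ) / ((n + 1 : ℕ) + 1))) with hδ
    have hδ0 : 0 < δ := Real.rpow_pos_of_pos hx _
    have hpow : (lam * (ε * δ)) ^ ((1 : ℝ) / (n + 1 : ℕ)) = δ⁻¹ := by
      rw [← mul_assoc]; exact vdc_rpow hx n
    set C : ℝ := 5 * 2 ^ n - 2 with hC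
    have hC0 : 0 ≤ C := by
      have : (1 : ℝ) ≤ 2 ^ n := one_le_pow₀ (by norm_num)
      rw [hC]; linarith
    set F : ℝ → ℂ := fun t => Complex.exp (Complex.I * (lam : ℂ) * (Φ 0 t : ℂ)) with hF
    have hFc : ContinuousOn F (Icc a b) := by
      have h0 : ContinuousOn (Φ 0) (Icc a b) :=
        fun t ht => (hΦ 0 (by omega) t ht).continuousWithinAt
      have : ContinuousOn (fun t => (Φ 0 t : ℂ)) (Icc a b) :=
        Complex.continuous_ofReal.comp_continuousOn h0
      exact Complex.continuous_exp.comp_continuousOn (continuousOn_const.mul this)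
    have hFi : ∀ p ∈ Icc a b, ∀ q ∈ Icc a b, IntervalIntegrable F volume p q := by
      intro p hp q hq
      exact (hFc.mono (uIcc_subset_Icc hp hq)).intervalIntegrable
    have hmono : MonotoneOn (Φ (n + 1)) (Icc a b) ∨ AntitoneOn (Φ (n + 1)) (Icc a b) := by
      have hcont : ContinuousOn (Φ (n + 1)) (Icc a b) :=
        fun t ht => (hder t ht).continuousWithinAt
      have hinj : InjOn (Φ (n + 1)) (Icc a b) := by
        intro s hs t ht hst
        have h1 := vdc_expand hder hΦε hs ht
        rw [hst, sub_self, abs_zero] at h1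
        have h2 : |t - s| ≤ 0 := by
          by_contra hcon
          have := mul_pos hε (not_le.1 hcon)
          linarith
        have h3 := abs_nonpos_iff.1 h2
        linarith
      exact (hcont.strictMonoOn_of_injOn_Icc' hab.le hinj).imp
        StrictMonoOn.monotoneOn StrictAntiOn.antitoneOn
    have houter : ∀ p ∈ Icc a b, ∀ q ∈ Icc a b, p ≤ q →
        (p < q → ∀ t ∈ Icc p q, δ ≤ |t - c|) → ‖∫ t in p..q, F t‖ ≤ C * δ := by
      intro p hp q hq hpq hfar
      rcases hpq.eq_or_lt with h | h
      · rw [h, intervalIntegral.integral_same, norm_zero]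
        positivity
      have hsub : Icc p q ⊆ Icc a b := Icc_subset_Icc hp.1 hq.2
      have := ih p q (ε * δ) h (mul_pos hε hδ0) Φ
        (fun k hk t ht => (hΦ k (by omega) t (hsub ht)).mono hsub)
        (fun t ht => (mul_le_mul_of_nonneg_left (hfar h t ht) hε.le).trans (hcen t (hsub ht)))
        (fun hn => by
          subst hn
          exact ⟨⟨Φ 2, fun t ht => (hder t (hsub ht)).mono hsub⟩,
            hmono.imp (fun hm => hm.mono hsub) (fun hm => hm.mono hsub)⟩)
      rw [hpow, div_inv_eq_mul] at this
      exact this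
    set p : ℝ := max a (c - δ) with hp
    set q : ℝ := min b (c + δ) with hq
    have hpc : p ≤ c := max_le hc.1 (by linarith)
    have hcq : c ≤ q := le_min hc.2 (by linarith)
    have hpm : p ∈ Icc a b := ⟨le_max_left _ _, hpc.trans hc.2⟩
    have hqm : q ∈ Icc a b := ⟨hc.1.trans hcq, min_le_left _ _⟩
    have ha : a ∈ Icc a b := left_mem_Icc.2 hab.le
    have hb : b ∈ Icc a b := right_mem_Icc.2 hab.le
    have h1 : ‖∫ t in a..p, F t‖ ≤ C * δ := by
      refine houter a ha p hpm hpm.1 (fun hlt t ht => ?_)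
      have : p = c - δ := by
        rcases max_choice a (c - δ) with h | h
        · rw [← hp] at h; linarith
        · exact h
      have h2 := ht.2
      rw [abs_sub_comm]
      exact le_trans (by linarith) (le_abs_self _)
    have h3 : ‖∫ t in q..b, F t‖ ≤ C * δ := by
      refine houter q hqm b hb hqm.2 (fun hlt t ht => ?_)
      have : q = c + δ := by
        rcases min_choice b (c + δ) with h | h
        · rw [← hq] at h; linarith
        · exact h
      have h2 := ht.1
      exact le_trans (by linarith) (le_abs_self _)
    have h2 : ‖∫ t in p..q, F t‖ ≤ 2 * δ := by
      have := intervalIntegral.norm_integral_le_of_norm_le_const (a := p) (b := q) (f := F)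
        (C := 1) (fun t _ => (vdc_norm lam (Φ 0 t)).le)
      rw [one_mul, abs_of_nonneg (by linarith)] at this
      have e1 : c - δ ≤ p := le_max_right _ _
      have e2 : q ≤ c + δ := min_le_right _ _
      linarith
    have hsplit : ∫ t in a..b, F t =
        (∫ t in a..p, F t) + (∫ t in p..q, F t) + ∫ t in q..b, F t := by
      rw [intervalIntegral.integral_add_adjacent_intervals (hFi a ha p hpm) (hFi p hpm q hqm),
        intervalIntegral.integral_add_adjacent_intervals (hFi a ha q hqm) (hFi q hqm b hb)]
    have hfin : (5 * 2 ^ (n + 1) - 2 : ℝ) / (lam * ε) ^ ((1 : ℝ) / (n + 1 + 1 : ℕ)) =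
        C * δ + 2 * δ + C * δ := by
      rw [hδ, Real.rpow_neg hx.le, hC, pow_succ]
      push_cast
      ring
    rw [hfin, hsplit]
    exact (norm_add₃_le).trans (add_le_add (add_le_add h1 h2) h3)

/-- The classical van der Corput lemma (without amplitude): `Φ 0 = φ` and `Φ (k+1)` is the
derivative of `Φ k` on `[a,b]` for `k < d`, with `|φ^{(d)}| ≥ ε` on `[a,b]`; if `d = 1` we
additionally assume `φ` is twice differentiable with monotone derivative.  Then
`|∫_a^b e^{iλφ(t)} dt| ≤ c_d/(λε)^{1/d}` with `c_d = 5·2^{d-1} - 2`, a bound independent of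
`a` and `b`. -/
theorem vanDerCorput
    (a b ε lam : ℝ) (hab : a < b) (d : ℕ) (hd : 1 ≤ d) (hε : 0 < ε) (hlam : 0 < lam)
    (Φ : ℕ → ℝ → ℝ)
    (hΦ : ∀ k < d, ∀ t ∈ Set.Icc a b, HasDerivWithinAt (Φ k) (Φ (k + 1) t) (Set.Icc a b) t)
    (hΦε : ∀ t ∈ Set.Icc a b, ε ≤ |Φ d t|)
    (hd1 : d = 1 →
      (∃ φ'' : ℝ → ℝ, ∀ t ∈ Set.Icc a b, HasDerivWithinAt (Φ 1) (φ'' t) (Set.Icc a b) t) ∧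
      (MonotoneOn (Φ 1) (Set.Icc a b) ∨ AntitoneOn (Φ 1) (Set.Icc a b))) :
    ‖∫ t in a..b, Complex.exp (Complex.I * (lam : ℂ) * (Φ 0 t : ℂ))‖ ≤
      (5 * 2 ^ (d - 1) - 2 : ℝ) / (lam * ε) ^ ((1 : ℝ) / d) := by
  obtain ⟨n, rfl⟩ : ∃ n, d = n + 1 := ⟨d - 1, by omega⟩
  exact vdc_main lam hlam n a b ε hab hε Φ hΦ hΦε (fun hn => hd1 (by omega))
end

section
/- Let m ≥ 2 and d ≥ 1 be integers, let ε > 0 and λ > 0, and write points of ℝ^m as y = (y', t) with y' ∈ ℝ^{m−1} and t ∈ ℝ. Let A ⊆ ℝ^m be a Lebesgue measurable set such that for every y' ∈ ℝ^{m−1} the fiber A_{y'} = { t ∈ ℝ : (y', t) ∈ A } is an open interval (possibly empty or unbounded). Let g : ℝ^{m−1} → ℝ be measurable, and let h : A → ℝ be such that for each y', the function t ↦ h(y', t) is differentiable on A_{y'}, Lebesgue integrable on A_{y'}, bounded on A_{y'}, and has Lebesgue integrable derivative ∂_t h(y', ·) on A_{y'}. Let φ : A → ℝ be such that for each y', the function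 t ↦ φ(y', t) is d-times differentiable on A_{y'} with |∂_t^d φ(y', t)| ≥ ε for all t ∈ A_{y'}; if d = 1, additionally assume that t ↦ φ(y', t) is twice differentiable with ∂_t φ(y', ·) monotonic on A_{y'}. Assume moreover that (y', t) ↦ g(y') h(y', t) is Lebesgue integrable on A and that the function y' ↦ |g(y')| · ( sup_{t ∈ A_{y'}} |h(y', t)| + ∫_{A_{y'}} |∂_t h(y', t)| dt ) is Lebesgue integrable on ℝ^{m−1}. Then | ∫_A g(y') h(y', t) e^{iλφ(y', t)} dy | ≤ ( c_d / (λε)^{1/d} ) · ∫_{ℝ^{m−1}} |g(y')| ( sup_{t ∈ A_{y'}} |h(y', t)| + ∫_{A_{y'}} |∂_t h(y', t)| dt ) dy', where c_d = 5·2^{d−1} − 2. -/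
open MeasureTheory Set Filter


lemma vdc_conj (a b : ℝ) (φ : ℝ → ℝ) :
    ‖∫ t in a..b, Complex.exp (Complex.I * ((-φ t : ℝ) : ℂ))‖ =
    ‖∫ t in a..b, Complex.exp (Complex.I * (φ t : ℂ))‖ := by
  have : ∀ t, Complex.exp (Complex.I * ((-φ t : ℝ) : ℂ)) =
      (starRingEnd ℂ) (Complex.exp (Complex.I * (φ t : ℂ))) := by
    intro t
    rw [← Complex.exp_conj]
    simp
  simp_rw [this]
  rw [intervalIntegral, intervalIntegral, integral_conj, integral_conj, ← map_sub,
    RCLike.norm_conj]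

lemma vdc_cont {a b : ℝ} {φ φ' : ℝ → ℝ} (h1 : ∀ t ∈ Icc a b, HasDerivAt φ (φ' t) t) :
    ContinuousOn (fun t => Complex.exp (Complex.I * (φ t : ℂ))) (Icc a b) := by
  have : ContinuousOn φ (Icc a b) := fun t ht => (h1 t ht).continuousAt.continuousWithinAt
  fun_prop

lemma vdc_one_mono {a b : ℝ} (hab : a < b) {μ : ℝ} (hμ : 0 < μ) {φ φ' φ'' : ℝ → ℝ}
    (h1 : ∀ t ∈ Icc a b, HasDerivAt φ (φ' t) t)
    (h2 : ∀ t ∈ Icc a b, HasDerivAt φ' (φ'' t) t)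
    (hm : MonotoneOn φ' (Icc a b)) (hε : ∀ t ∈ Icc a b, μ ≤ |φ' t|) :
    ‖∫ t in a..b, Complex.exp (Complex.I * (φ t : ℂ))‖ ≤ 3 / μ := by
  have hne : ∀ t ∈ Icc a b, φ' t ≠ 0 := fun t ht h0 => by
    have := hε t ht
    rw [h0, abs_zero] at this
    linarith
  have hpos : ∀ t ∈ Icc a b, 0 ≤ φ'' t := fun t ht =>
    (h2 t ht).hasDerivWithinAt.nonneg_of_monotoneOn
      ((uniqueDiffWithinAt_iff_accPt).1 (uniqueDiffOn_Icc hab t ht)) hm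
  have hua : a ∈ Icc a b := left_mem_Icc.2 hab.le
  have hub : b ∈ Icc a b := right_mem_Icc.2 hab.le
  have hsign := hasDerivWithinAt_forall_lt_or_forall_gt_of_forall_ne (convex_Icc a b)
    (fun t ht => (h1 t ht).hasDerivWithinAt) hne
  have hv : ∀ t ∈ Icc a b, HasDerivAt (fun s => -(φ' s)⁻¹) (φ'' t / φ' t ^ 2) t := by
    intro t ht
    have := ((h2 t ht).inv (hne t ht)).neg
    convert! this using 1
    ring
  have hvc : ContinuousOn (fun s => -(φ' s)⁻¹) (Icc a b) :=
    fun t ht => (hv t ht).continuousAt.continuousWithinAt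
  have hv' : ∀ t ∈ Icc a b, 0 ≤ φ'' t / φ' t ^ 2 := fun t ht =>
    div_nonneg (hpos t ht) (sq_nonneg _)
  have hvi : IntervalIntegrable (fun t => φ'' t / φ' t ^ 2) volume a b := by
    rw [intervalIntegrable_iff_integrableOn_Ioc_of_le hab.le]
    exact intervalIntegral.integrableOn_deriv_of_nonneg hvc
      (fun t ht => hv t (Ioo_subset_Icc_self ht)) (fun t ht => hv' t (Ioo_subset_Icc_self ht))
  have hvint : ∫ t in a..b, φ'' t / φ' t ^ 2 = (φ' a)⁻¹ - (φ' b)⁻¹ := by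
    rw [intervalIntegral.integral_eq_sub_of_hasDerivAt
      (fun t ht => hv t (by rwa [uIcc_of_le hab.le] at ht)) hvi]
    ring
  have hinv : ∀ t ∈ Icc a b, |(φ' t)⁻¹| ≤ 1 / μ := by
    intro t ht
    rw [abs_inv, one_div]
    exact inv_anti₀ hμ (hε t ht)
  have hdiff : (φ' a)⁻¹ - (φ' b)⁻¹ ≤ 1 / μ := by
    have ha := abs_le.1 (hinv a hua)
    have hb := abs_le.1 (hinv b hub)
    rcases hsign with hs | hs
    · have := inv_lt_zero.2 (hs a hua)
      linarith
    · have := inv_pos.2 (hs b hub)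
      linarith
  have hec := vdc_cont h1
  have hE : ∀ t ∈ Icc a b, HasDerivAt (fun s => Complex.exp (Complex.I * (φ s : ℂ)))
      (Complex.exp (Complex.I * (φ t : ℂ)) * (Complex.I * (φ' t : ℂ))) t := by
    intro t ht
    exact (((h1 t ht).ofReal_comp).const_mul Complex.I).cexp
  have hW : ∀ t ∈ Icc a b, HasDerivAt
      (fun s => ((-(φ' s)⁻¹ : ℝ) : ℂ) * Complex.exp (Complex.I * (φ s : ℂ)))
      (((φ'' t / φ' t ^ 2 : ℝ) : ℂ) * Complex.exp (Complex.I * (φ t : ℂ))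
        - Complex.I * Complex.exp (Complex.I * (φ t : ℂ))) t := by
    intro t ht
    have := ((hv t ht).ofReal_comp).mul (hE t ht)
    convert! this using 1
    have h0 : (φ' t : ℂ) ≠ 0 := by exact_mod_cast hne t ht
    push_cast
    field_simp
    ring
  have hei : IntervalIntegrable (fun t => Complex.exp (Complex.I * (φ t : ℂ))) volume a b := by
    apply ContinuousOn.intervalIntegrable
    rwa [uIcc_of_le hab.le]
  have hvi2 : IntervalIntegrable (fun t => ((φ'' t / φ' t ^ 2 : ℝ) : ℂ) *
      Complex.exp (Complex.I * (φ t : ℂ))) volume a b := by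
    apply IntervalIntegrable.mul_continuousOn
    · exact ⟨hvi.1.ofReal, hvi.2.ofReal⟩
    · rwa [uIcc_of_le hab.le]
  have key := intervalIntegral.integral_eq_sub_of_hasDerivAt
      (fun t ht => hW t (by rwa [uIcc_of_le hab.le] at ht)) (hvi2.sub (hei.const_mul Complex.I))
  rw [intervalIntegral.integral_sub hvi2 (hei.const_mul Complex.I),
    intervalIntegral.integral_const_mul] at key
  have hb1 : ‖∫ t in a..b, ((φ'' t / φ' t ^ 2 : ℝ) : ℂ) *
      Complex.exp (Complex.I * (φ t : ℂ))‖ ≤ 1 / μ := by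
    rw [← hvint] at hdiff
    refine le_trans (intervalIntegral.norm_integral_le_of_norm_le hab.le ?_ hvi) hdiff
    refine Eventually.of_forall fun t ht => ?_
    rw [norm_mul, Complex.norm_exp_I_mul_ofReal, mul_one, Complex.norm_real, Real.norm_eq_abs,
      abs_of_nonneg (hv' t (Ioc_subset_Icc_self ht))]
  have hbd : ∀ t ∈ Icc a b, ‖((-(φ' t)⁻¹ : ℝ) : ℂ) * Complex.exp (Complex.I * (φ t : ℂ))‖
      ≤ 1 / μ := by
    intro t ht
    rw [norm_mul, Complex.norm_exp_I_mul_ofReal, mul_one, Complex.norm_real, Real.norm_eq_abs,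
      abs_neg]
    exact hinv t ht
  have e1 : ‖∫ t in a..b, Complex.exp (Complex.I * (φ t : ℂ))‖ =
      ‖Complex.I * ∫ t in a..b, Complex.exp (Complex.I * (φ t : ℂ))‖ := by simp
  rw [e1]
  have e2 := eq_sub_of_add_eq' (sub_eq_iff_eq_add'.1 key).symm
  rw [sub_eq_iff_eq_add] at key
  have e3 : Complex.I * ∫ t in a..b, Complex.exp (Complex.I * (φ t : ℂ)) =
    (∫ t in a..b, ((φ'' t / φ' t ^ 2 : ℝ) : ℂ) * Complex.exp (Complex.I * (φ t : ℂ)))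
      - (((-(φ' b)⁻¹ : ℝ) : ℂ) * Complex.exp (Complex.I * (φ b : ℂ))
        - ((-(φ' a)⁻¹ : ℝ) : ℂ) * Complex.exp (Complex.I * (φ a : ℂ))) := by
    rw [key]; ring
  rw [e3]
  refine (norm_sub_le _ _).trans ?_
  have := norm_sub_le (((-(φ' b)⁻¹ : ℝ) : ℂ) * Complex.exp (Complex.I * (φ b : ℂ)))
    (((-(φ' a)⁻¹ : ℝ) : ℂ) * Complex.exp (Complex.I * (φ a : ℂ)))
  have t1 := hbd a hua
  have t2 := hbd b hub
  have : 3 / μ = 1 / μ + (1 / μ + 1 / μ) := by ring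
  linarith

lemma vdc_one {a b : ℝ} (hab : a ≤ b) {μ : ℝ} (hμ : 0 < μ) {φ φ' φ'' : ℝ → ℝ}
    (h1 : ∀ t ∈ Icc a b, HasDerivAt φ (φ' t) t)
    (h2 : ∀ t ∈ Icc a b, HasDerivAt φ' (φ'' t) t)
    (hm : MonotoneOn φ' (Icc a b) ∨ AntitoneOn φ' (Icc a b))
    (hε : ∀ t ∈ Icc a b, μ ≤ |φ' t|) :
    ‖∫ t in a..b, Complex.exp (Complex.I * (φ t : ℂ))‖ ≤ 3 / μ := by
  rcases hab.eq_or_lt with rfl | hab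
  · simp; positivity
  rcases hm with hm | hm
  · exact vdc_one_mono hab hμ h1 h2 hm hε
  · rw [← vdc_conj]
    exact vdc_one_mono (φ' := fun t => -φ' t) (φ'' := fun t => -φ'' t) hab hμ
      (fun t ht => (h1 t ht).neg) (fun t ht => (h2 t ht).neg) hm.neg (by simpa using hε)

/-- The extra hypothesis for `d = 1`. -/
def VdcExtra (a b : ℝ) (φ' : ℝ → ℝ) : Prop :=
  (∃ φ'' : ℝ → ℝ, ∀ t ∈ Icc a b, HasDerivAt φ' (φ'' t) t) ∧
    (MonotoneOn φ' (Icc a b) ∨ AntitoneOn φ' (Icc a b))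

lemma vdc_zero_pt {a b : ℝ} (hab : a ≤ b) {μ : ℝ} (hμ : 0 < μ) {f : ℝ → ℝ}
    (hf : ContinuousOn f (Icc a b))
    (hs : ∀ x ∈ Icc a b, ∀ y ∈ Icc a b, x ≤ y → μ * (y - x) ≤ f y - f x) :
    ∃ c ∈ Icc a b, ∀ x ∈ Icc a b, μ * |x - c| ≤ |f x| := by
  have hua : a ∈ Icc a b := left_mem_Icc.2 hab
  have hub : b ∈ Icc a b := right_mem_Icc.2 hab
  rcases le_or_gt 0 (f a) with h0 | h0
  · refine ⟨a, hua, fun x hx => ?_⟩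
    have := hs a hua x hx hx.1
    rw [abs_of_nonneg (sub_nonneg.2 hx.1)]
    exact le_trans (by linarith) (le_abs_self _)
  rcases le_or_gt (f b) 0 with h1 | h1
  · refine ⟨b, hub, fun x hx => ?_⟩
    have := hs x hx b hub hx.2
    rw [abs_sub_comm, abs_of_nonneg (sub_nonneg.2 hx.2)]
    exact le_trans (by linarith) (neg_le_abs _)
  obtain ⟨c, hc, hfc⟩ := intermediate_value_Icc hab hf ⟨h0.le, h1.le⟩
  refine ⟨c, hc, fun x hx => ?_⟩
  rcases le_total c x with hx' | hx'
  · have := hs c hc x hx hx'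
    rw [abs_of_nonneg (sub_nonneg.2 hx')]
    exact le_trans (by linarith) (le_abs_self _)
  · have := hs x hx c hc hx'
    rw [abs_sub_comm, abs_of_nonneg (sub_nonneg.2 hx')]
    exact le_trans (by linarith) (neg_le_abs _)

def VdcConcl (d : ℕ) : Prop :=
  ∀ (a b : ℝ), a ≤ b → ∀ μ : ℝ, 0 < μ → ∀ Φ : ℕ → ℝ → ℝ,
    (∀ k < d, ∀ t ∈ Icc a b, HasDerivAt (Φ k) (Φ (k + 1) t) t) →
    (∀ t ∈ Icc a b, μ ≤ |Φ d t|) → (d = 1 → VdcExtra a b (Φ 1)) →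
    ‖∫ t in a..b, Complex.exp (Complex.I * (Φ 0 t : ℂ))‖ ≤
      (5 * 2 ^ (d - 1) - 2 : ℝ) / μ ^ ((1 : ℝ) / d)

lemma vdc_cd (d : ℕ) : (0 : ℝ) ≤ 5 * 2 ^ (d - 1) - 2 := by
  have : (1 : ℝ) ≤ 2 ^ (d - 1) := one_le_pow₀ (by norm_num)
  linarith

lemma vdc_step_pos (d : ℕ) (hd : 1 ≤ d) (ih : VdcConcl d) (a b : ℝ) (hab : a ≤ b)
    (μ : ℝ) (hμ : 0 < μ) (Φ : ℕ → ℝ → ℝ)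
    (h1 : ∀ k < d + 1, ∀ t ∈ Icc a b, HasDerivAt (Φ k) (Φ (k + 1) t) t)
    (hε : ∀ t ∈ Icc a b, μ ≤ Φ (d + 1) t) :
    ‖∫ t in a..b, Complex.exp (Complex.I * (Φ 0 t : ℂ))‖ ≤
      (5 * 2 ^ (d + 1 - 1) - 2 : ℝ) / μ ^ ((1 : ℝ) / (d + 1 : ℕ)) := by
  have hfc : ContinuousOn (Φ d) (Icc a b) := fun t ht =>
    (h1 d (by omega) t ht).continuousAt.continuousWithinAt
  have hs : ∀ x ∈ Icc a b, ∀ y ∈ Icc a b, x ≤ y → μ * (y - x) ≤ Φ d y - Φ d x := by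
    refine (convex_Icc a b).mul_sub_le_image_sub_of_le_deriv hfc ?_ ?_
    · intro t ht
      exact (h1 d (by omega) t (interior_subset ht)).differentiableAt.differentiableWithinAt
    · intro t ht
      rw [(h1 d (by omega) t (interior_subset ht)).deriv]
      exact hε t (interior_subset ht)
  have hmono : MonotoneOn (Φ d) (Icc a b) := by
    intro x hx y hy hxy
    have := hs x hx y hy hxy
    have : 0 ≤ μ * (y - x) := mul_nonneg hμ.le (sub_nonneg.2 hxy)
    linarith
  obtain ⟨c, hc, hcb⟩ := vdc_zero_pt hab hμ hfc hs
  set R : ℝ := μ ^ ((1 : ℝ) / (d + 1 : ℕ)) with hR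
  have hRpos : 0 < R := Real.rpow_pos_of_pos hμ _
  set δ : ℝ := 1 / R with hδ
  have hδpos : 0 < δ := by positivity
  have hdR : (0 : ℝ) < d := by exact_mod_cast hd
  have hpow : (μ * δ) ^ ((1 : ℝ) / d) = R := by
    have : μ * δ = μ ^ (1 - (1 : ℝ) / (d + 1 : ℕ)) := by
      rw [Real.rpow_sub hμ, Real.rpow_one, hδ, hR]; ring
    rw [this, ← Real.rpow_mul hμ.le, hR]
    congr 1
    push_cast
    field_simp
    ring
  have hei : ∀ x ∈ Icc a b, ∀ y ∈ Icc a b,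
      IntervalIntegrable (fun t => Complex.exp (Complex.I * (Φ 0 t : ℂ))) volume x y := by
    intro x hx y hy
    apply ContinuousOn.intervalIntegrable
    exact (vdc_cont (h1 0 (by omega))).mono ((ordConnected_Icc).uIcc_subset hx hy)
  have hsub : ∀ x ∈ Icc a b, ∀ y ∈ Icc a b, x ≤ y → (∀ t ∈ Icc x y, δ ≤ |t - c|) →
      ‖∫ t in x..y, Complex.exp (Complex.I * (Φ 0 t : ℂ))‖ ≤
        (5 * 2 ^ (d - 1) - 2 : ℝ) / R := by
    intro x hx y hy hxy hδt
    have hss : Icc x y ⊆ Icc a b := Icc_subset_Icc hx.1 hy.2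
    rw [← hpow]
    refine ih x y hxy (μ * δ) (by positivity) Φ
      (fun k hk t ht => h1 k (by omega) t (hss ht)) ?_ ?_
    · intro t ht
      refine le_trans ?_ (hcb t (hss ht))
      exact mul_le_mul_of_nonneg_left (hδt t ht) hμ.le
    · rintro rfl
      exact ⟨⟨Φ 2, fun t ht => h1 1 (by omega) t (hss ht)⟩, Or.inl (hmono.mono hss)⟩
  have hcd : (0 : ℝ) ≤ (5 * 2 ^ (d - 1) - 2 : ℝ) / R := div_nonneg (vdc_cd d) hRpos.le
  set p := max a (c - δ) with hp
  set q := min b (c + δ) with hq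
  have hap : a ≤ p := le_max_left _ _
  have hpc : p ≤ c := max_le hc.1 (by linarith)
  have hcq : c ≤ q := le_min hc.2 (by linarith)
  have hqb : q ≤ b := min_le_left _ _
  have hpI : p ∈ Icc a b := ⟨hap, hpc.trans hc.2⟩
  have hqI : q ∈ Icc a b := ⟨hc.1.trans hcq, hqb⟩
  have hua : a ∈ Icc a b := left_mem_Icc.2 hab
  have hub : b ∈ Icc a b := right_mem_Icc.2 hab
  have b1 : ‖∫ t in a..p, Complex.exp (Complex.I * (Φ 0 t : ℂ))‖ ≤
      (5 * 2 ^ (d - 1) - 2 : ℝ) / R := by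
    rcases le_total (c - δ) a with h | h
    · have : p = a := max_eq_left h
      rw [this]; simpa using hcd
    · have : p = c - δ := max_eq_right h
      refine hsub a hua p hpI hap fun t ht => ?_
      rw [abs_sub_comm]
      exact le_trans (by linarith [ht.2]) (le_abs_self _)
  have b3 : ‖∫ t in q..b, Complex.exp (Complex.I * (Φ 0 t : ℂ))‖ ≤
      (5 * 2 ^ (d - 1) - 2 : ℝ) / R := by
    rcases le_total b (c + δ) with h | h
    · have : q = b := min_eq_left h
      rw [this]; simpa using hcd
    · have : q = c + δ := min_eq_right h
      refine hsub q hqI b hub hqb fun t ht => ?_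
      exact le_trans (by linarith [ht.1]) (le_abs_self _)
  have b2 : ‖∫ t in p..q, Complex.exp (Complex.I * (Φ 0 t : ℂ))‖ ≤ 2 * δ := by
    have := intervalIntegral.norm_integral_le_of_norm_le_const (a := p) (b := q) (C := 1)
      (f := fun t => Complex.exp (Complex.I * (Φ 0 t : ℂ)))
      (fun t _ => by rw [Complex.norm_exp_I_mul_ofReal])
    refine this.trans ?_
    rw [abs_of_nonneg (by linarith), one_mul]
    have := le_max_right a (c - δ)
    have := min_le_right b (c + δ)
    linarith
  rw [← intervalIntegral.integral_add_adjacent_intervals (hei a hua q hqI) (hei q hqI b hub),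
    ← intervalIntegral.integral_add_adjacent_intervals (hei a hua p hpI) (hei p hpI q hqI)]
  refine (norm_add_le _ _).trans ?_
  have := norm_add_le (∫ t in a..p, Complex.exp (Complex.I * (Φ 0 t : ℂ)))
    (∫ t in p..q, Complex.exp (Complex.I * (Φ 0 t : ℂ)))
  have e : (5 * 2 ^ (d + 1 - 1) - 2 : ℝ) / R =
      (5 * 2 ^ (d - 1) - 2 : ℝ) / R + 2 * δ + (5 * 2 ^ (d - 1) - 2 : ℝ) / R := by
    obtain ⟨e, rfl⟩ := Nat.exists_eq_add_of_le' hd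
    simp only [Nat.add_sub_cancel, hδ, pow_succ]
    ring
  rw [e]
  linarith

lemma vdc_all (d : ℕ) (hd : 1 ≤ d) : VdcConcl d := by
  induction d, hd using Nat.le_induction with
  | base =>
    intro a b hab μ hμ Φ h1 hε hx
    obtain ⟨⟨φ'', h2⟩, hm⟩ := hx rfl
    have := vdc_one hab hμ (h1 0 (by norm_num)) h2 hm hε
    norm_num at this ⊢
    exact this
  | succ d hd ih =>
    intro a b hab μ hμ Φ h1 hε _
    have hne : ∀ t ∈ Icc a b, Φ (d + 1) t ≠ 0 := fun t ht h0 => by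
      have := hε t ht
      rw [h0, abs_zero] at this
      linarith
    rcases hasDerivWithinAt_forall_lt_or_forall_gt_of_forall_ne (convex_Icc a b)
      (fun t ht => (h1 d (by omega) t ht).hasDerivWithinAt) hne with hs | hs
    · rw [← vdc_conj]
      refine vdc_step_pos d hd ih a b hab μ hμ (fun k t => -Φ k t)
        (fun k hk t ht => (h1 k hk t ht).neg) fun t ht => ?_
      have := hε t ht
      rwa [abs_of_neg (hs t ht)] at this
    · refine vdc_step_pos d hd ih a b hab μ hμ Φ h1 fun t ht => ?_
      have := hε t ht
      rwa [abs_of_pos (hs t ht)] at this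

lemma vdc_amp {a b : ℝ} (hab : a ≤ b) {K : ℝ} {e : ℝ → ℂ} (he : ContinuousOn e (Icc a b))
    (hK : ∀ t ∈ Icc a b, ‖∫ s in a..t, e s‖ ≤ K) {h h' : ℝ → ℝ}
    (hh : ∀ t ∈ Icc a b, HasDerivAt h (h' t) t)
    (hi : IntegrableOn h' (Icc a b)) :
    ‖∫ t in a..b, (h t : ℂ) * e t‖ ≤ K * (|h b| + ∫ t in Icc a b, |h' t|) := by
  have hu : uIcc a b = Icc a b := uIcc_of_le hab
  have hei : IntegrableOn e (uIcc a b) := by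
    rw [hu]; exact he.integrableOn_Icc
  have hii : IntervalIntegrable h' volume a b := by
    rw [intervalIntegrable_iff_integrableOn_Icc_of_le hab]; exact hi
  have hFc : ContinuousOn (fun x => ∫ t in a..x, e t) (Icc a b) := by
    have := intervalIntegral.continuousOn_primitive_interval hei
    rwa [hu] at this
  have key := intervalIntegral.integral_mul_deriv_eq_deriv_mul_of_hasDeriv_right
    (a := a) (b := b) (u := fun t => (h t : ℂ)) (u' := fun t => (h' t : ℂ))
    (v := fun x => ∫ t in a..x, e t) (v' := e) ?_ (by rwa [hu]) ?_ ?_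
    ⟨hii.1.ofReal, hii.2.ofReal⟩ (he.intervalIntegrable_of_Icc hab)
  · rw [key]
    simp only [intervalIntegral.integral_same, mul_zero, sub_zero]
    refine (norm_sub_le _ _).trans ?_
    have b1 : ‖(h b : ℂ) * ∫ t in a..b, e t‖ ≤ K * |h b| := by
      rw [norm_mul, Complex.norm_real, Real.norm_eq_abs, mul_comm]
      exact mul_le_mul_of_nonneg_right (hK b (right_mem_Icc.2 hab)) (abs_nonneg _)
    have b2 : ‖∫ x in a..b, (h' x : ℂ) * ∫ t in a..x, e t‖ ≤ K * ∫ t in Icc a b, |h' t| := by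
      rw [integral_Icc_eq_integral_Ioc, ← intervalIntegral.integral_of_le hab,
        ← intervalIntegral.integral_const_mul]
      refine intervalIntegral.norm_integral_le_of_norm_le hab ?_ (hii.abs.const_mul K)
      refine Eventually.of_forall fun t ht => ?_
      rw [norm_mul, Complex.norm_real, Real.norm_eq_abs, mul_comm]
      exact mul_le_mul_of_nonneg_right (hK t (Ioc_subset_Icc_self ht)) (abs_nonneg _)
    linarith
  · rw [hu]
    exact fun t ht => (hh t ht).ofReal_comp.continuousAt.continuousWithinAt
  · rw [min_eq_left hab, max_eq_right hab]
    exact fun t ht => (hh t (Ioo_subset_Icc_self ht)).ofReal_comp.hasDerivWithinAt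
  · rw [min_eq_left hab, max_eq_right hab]
    intro t ht
    have hio : ContinuousOn e (Ioo a b) := he.mono Ioo_subset_Icc_self
    refine (intervalIntegral.integral_hasDerivAt_right ?_
      (hio.stronglyMeasurableAtFilter isOpen_Ioo t ht)
      (hio.continuousAt (isOpen_Ioo.mem_nhds ht))).hasDerivWithinAt
    exact (he.mono (Icc_subset_Icc le_rfl ht.2.le)).intervalIntegrable_of_Icc ht.1.le

lemma vdc_exhaust {S : Set ℝ} (hSo : IsOpen S) (hSc : S.OrdConnected) (f : ℝ → ℂ)
    (hf : IntegrableOn f S) {B : ℝ} (hB0 : 0 ≤ B)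
    (hB : ∀ a b, a ≤ b → Icc a b ⊆ S → ‖∫ t in Icc a b, f t‖ ≤ B) :
    ‖∫ t in S, f t‖ ≤ B := by
  rcases S.eq_empty_or_nonempty with rfl | ⟨x0, hx0⟩
  · simpa using hB0
  obtain ⟨F, hFc, hFs, hFu, hFm⟩ := hSo.exists_iUnion_isClosed
  let K : ℕ → Set ℝ := fun n => F n ∩ Icc (-(n : ℝ)) n
  have hKc : ∀ n, IsCompact (K n) := fun n => isCompact_Icc.inter_left (hFc n)
  have hKS : ∀ n, K n ⊆ S := fun n => inter_subset_left.trans (hFs n)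
  have hKev : ∀ x ∈ S, ∀ᶠ n in atTop, x ∈ K n := by
    intro x hx
    rw [← hFu] at hx
    obtain ⟨n, hn⟩ := mem_iUnion.1 hx
    obtain ⟨k, hk⟩ := exists_nat_ge |x|
    filter_upwards [eventually_ge_atTop n, eventually_ge_atTop k] with j hj1 hj2
    have : (k : ℝ) ≤ j := by exact_mod_cast hj2
    exact ⟨hFm hj1 hn, abs_le.1 (hk.trans this)⟩
  let J : ℕ → Set ℝ := fun n => Icc (sInf (K n)) (sSup (K n))
  have hKJ : ∀ n, K n ⊆ J n := fun n x hx =>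
    ⟨csInf_le (hKc n).bddBelow hx, le_csSup (hKc n).bddAbove hx⟩
  have hcov : AECover (volume.restrict S) atTop J := by
    refine ⟨?_, fun n => measurableSet_Icc⟩
    refine (ae_restrict_mem hSo.measurableSet).mono fun x hx => ?_
    exact (hKev x hx).mono fun n hn => hKJ n hn
  have hlim := (hcov.integral_tendsto_of_countably_generated hf).norm
  refine le_of_tendsto hlim ?_
  filter_upwards [hKev x0 hx0] with n hn
  have hne : (K n).Nonempty := ⟨x0, hn⟩
  have hJS : J n ⊆ S := hSc.out (hKS n ((hKc n).sInf_mem hne)) (hKS n ((hKc n).sSup_mem hne))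
  rw [Measure.restrict_restrict measurableSet_Icc, inter_eq_left.2 hJS]
  exact hB _ _ ((hKJ n hn).1.trans (hKJ n hn).2) hJS

lemma vdc_fiber {S : Set ℝ} (hSo : IsOpen S) (hSc : S.OrdConnected) (d : ℕ) (hd : 1 ≤ d)
    {μ : ℝ} (hμ : 0 < μ) {h h' : ℝ → ℝ} (hh : ∀ t ∈ S, HasDerivAt h (h' t) t)
    (hhi : IntegrableOn h S) {M : ℝ} (hM0 : 0 ≤ M) (hM : ∀ t ∈ S, |h t| ≤ M)
    (hh'i : IntegrableOn h' S) (Ψ : ℕ → ℝ → ℝ)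
    (hΨ : ∀ k < d, ∀ t ∈ S, HasDerivAt (Ψ k) (Ψ (k + 1) t) t)
    (hε : ∀ t ∈ S, μ ≤ |Ψ d t|)
    (hx : d = 1 → (∃ φ'' : ℝ → ℝ, ∀ t ∈ S, HasDerivAt (Ψ 1) (φ'' t) t) ∧
      (MonotoneOn (Ψ 1) S ∨ AntitoneOn (Ψ 1) S)) :
    ‖∫ t in S, (h t : ℂ) * Complex.exp (Complex.I * (Ψ 0 t : ℂ))‖ ≤
      ((5 * 2 ^ (d - 1) - 2 : ℝ) / μ ^ ((1 : ℝ) / d)) * (M + ∫ t in S, |h' t|) := by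
  have hC : 0 ≤ (5 * 2 ^ (d - 1) - 2 : ℝ) / μ ^ ((1 : ℝ) / d) :=
    div_nonneg (vdc_cd d) (Real.rpow_nonneg hμ.le _)
  have hI0 : 0 ≤ ∫ t in S, |h' t| := integral_nonneg fun t => abs_nonneg _
  have hec : ContinuousOn (fun t => Complex.exp (Complex.I * (Ψ 0 t : ℂ))) S := by
    have : ContinuousOn (Ψ 0) S := fun t ht =>
      (hΨ 0 (by omega) t ht).continuousAt.continuousWithinAt
    fun_prop
  refine vdc_exhaust hSo hSc _ ?_ (mul_nonneg hC (by positivity)) ?_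
  · refine Integrable.mul_bdd (c := 1) hhi.ofReal
      (hec.aestronglyMeasurable hSo.measurableSet) ?_
    exact Eventually.of_forall fun t => by rw [Complex.norm_exp_I_mul_ofReal]
  · intro a b hab hS
    rw [integral_Icc_eq_integral_Ioc, ← intervalIntegral.integral_of_le hab]
    refine (vdc_amp hab (hec.mono hS) (K := (5 * 2 ^ (d - 1) - 2 : ℝ) / μ ^ ((1 : ℝ) / d)) ?_
      (fun t ht => hh t (hS ht)) (hh'i.mono_set hS)).trans ?_
    · intro t ht
      have hS' : Icc a t ⊆ S := (Icc_subset_Icc le_rfl ht.2).trans hS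
      refine vdc_all d hd a t ht.1 μ hμ Ψ (fun k hk s hs => hΨ k hk s (hS' hs))
        (fun s hs => hε s (hS' hs)) ?_
      intro h1
      obtain ⟨⟨φ'', h2⟩, h3⟩ := hx h1
      exact ⟨⟨φ'', fun s hs => h2 s (hS' hs)⟩,
        h3.imp (fun h => h.mono hS') (fun h => h.mono hS')⟩
    · refine mul_le_mul_of_nonneg_left (add_le_add (hM b (hS (right_mem_Icc.2 hab))) ?_) hC
      exact setIntegral_mono_set hh'i.abs (Eventually.of_forall fun t => abs_nonneg _)
        hS.eventuallyLE

/-- Fiberwise van der Corput lemma with amplitude.  Points of `ℝ^m` are written `(y', t)`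
with `y' ∈ ℝ^{m-1}`, `t ∈ ℝ`.  The set `A` is measurable with every fiber
`A_{y'} = {t | (y', t) ∈ A}` an open interval (open and order-connected, possibly empty or
unbounded).  For every `y'`, `h(y', ·)` is differentiable with derivative `h'(y', ·)`,
integrable, bounded, and `h'(y', ·)` is integrable on `A_{y'}`; the phase `φ = Φ 0` is
`d`-times differentiable in `t` on `A_{y'}` (via the chain `Φ`) with `|∂_t^d φ| ≥ ε`, and if
`d = 1` it is twice differentiable in `t` with monotone `∂_t φ(y', ·)`.  If `(y',t) ↦ g(y')h(y',t)`
is integrable on `A` and `y' ↦ |g(y')| (sup_{A_{y'}} |h| + ∫_{A_{y'}} |∂_t h|)` is integrable,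
then `|∫_A g h e^{iλφ}| ≤ (c_d/(λε)^{1/d}) ∫ |g| (sup |h| + ∫ |∂_t h|)` with
`c_d = 5·2^{d-1} - 2`. -/
theorem fiberwise_vanDerCorput_amplitude
    (m d : ℕ) (hm : 2 ≤ m) (hd : 1 ≤ d) (ε lam : ℝ) (hε : 0 < ε) (hlam : 0 < lam)
    (A : Set ((Fin (m - 1) → ℝ) × ℝ)) (hAmeas : MeasurableSet A)
    (hAfib : ∀ y' : Fin (m - 1) → ℝ,
      IsOpen {t : ℝ | (y', t) ∈ A} ∧ ({t : ℝ | (y', t) ∈ A}).OrdConnected)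
    (g : (Fin (m - 1) → ℝ) → ℝ) (hg : Measurable g)
    (h h' : (Fin (m - 1) → ℝ) × ℝ → ℝ)
    (hhderiv : ∀ y' : Fin (m - 1) → ℝ, ∀ t ∈ {t : ℝ | (y', t) ∈ A},
      HasDerivAt (fun s => h (y', s)) (h' (y', t)) t)
    (hhint : ∀ y' : Fin (m - 1) → ℝ,
      MeasureTheory.IntegrableOn (fun t => h (y', t)) {t : ℝ | (y', t) ∈ A})
    (hhbdd : ∀ y' : Fin (m - 1) → ℝ, ∃ C : ℝ, ∀ t ∈ {t : ℝ | (y', t) ∈ A}, |h (y', t)| ≤ C)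
    (hh'int : ∀ y' : Fin (m - 1) → ℝ,
      MeasureTheory.IntegrableOn (fun t => h' (y', t)) {t : ℝ | (y', t) ∈ A})
    (Φ : ℕ → (Fin (m - 1) → ℝ) × ℝ → ℝ)
    (hΦ : ∀ y' : Fin (m - 1) → ℝ, ∀ k < d, ∀ t ∈ {t : ℝ | (y', t) ∈ A},
      HasDerivAt (fun s => Φ k (y', s)) (Φ (k + 1) (y', t)) t)
    (hΦε : ∀ p ∈ A, ε ≤ |Φ d p|)
    (hd1 : d = 1 → ∀ y' : Fin (m - 1) → ℝ,
      (∃ φ'' : ℝ → ℝ, ∀ t ∈ {t : ℝ | (y', t) ∈ A},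
        HasDerivAt (fun s => Φ 1 (y', s)) (φ'' t) t) ∧
      (MonotoneOn (fun s => Φ 1 (y', s)) {t : ℝ | (y', t) ∈ A} ∨
        AntitoneOn (fun s => Φ 1 (y', s)) {t : ℝ | (y', t) ∈ A}))
    (hghint : MeasureTheory.IntegrableOn
      (fun p : (Fin (m - 1) → ℝ) × ℝ => g p.1 * h p) A)
    (houter : MeasureTheory.Integrable (fun y' : Fin (m - 1) → ℝ =>
      |g y'| * ((⨆ t ∈ {t : ℝ | (y', t) ∈ A}, |h (y', t)|) +
        ∫ t in {t : ℝ | (y', t) ∈ A}, |h' (y', t)|))) :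
    ‖∫ p in A, (g p.1 : ℂ) * (h p : ℂ) * Complex.exp (Complex.I * (lam : ℂ) * (Φ 0 p : ℂ))‖ ≤
      ((5 * 2 ^ (d - 1) - 2 : ℝ) / (lam * ε) ^ ((1 : ℝ) / d)) *
        ∫ y' : Fin (m - 1) → ℝ,
          |g y'| * ((⨆ t ∈ {t : ℝ | (y', t) ∈ A}, |h (y', t)|) +
            ∫ t in {t : ℝ | (y', t) ∈ A}, |h' (y', t)|) := by
  have hμ : 0 < lam * ε := mul_pos hlam hε
  have hC : 0 ≤ (5 * 2 ^ (d - 1) - 2 : ℝ) / (lam * ε) ^ ((1 : ℝ) / d) :=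
    div_nonneg (vdc_cd d) (Real.rpow_nonneg hμ.le _)
  have hsup0 : ∀ y', 0 ≤ ⨆ t ∈ {t : ℝ | (y', t) ∈ A}, |h (y', t)| := fun y' =>
    Real.iSup_nonneg fun t => Real.iSup_nonneg fun _ => abs_nonneg _
  have hsup : ∀ y', ∀ t ∈ {t : ℝ | (y', t) ∈ A},
      |h (y', t)| ≤ ⨆ t ∈ {t : ℝ | (y', t) ∈ A}, |h (y', t)| := by
    intro y' t ht
    obtain ⟨C, hCb⟩ := hhbdd y'
    have hbdd : BddAbove (range fun t => ⨆ (_ : t ∈ {t : ℝ | (y', t) ∈ A}), |h (y', t)|) := by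
      refine ⟨max C 0, ?_⟩
      rintro _ ⟨s, rfl⟩
      exact Real.iSup_le (fun hs => (hCb s hs).trans (le_max_left _ _)) (le_max_right _ _)
    refine le_trans ?_ (le_ciSup hbdd t)
    rw [ciSup_pos ht]
  have hRHS : 0 ≤ ((5 * 2 ^ (d - 1) - 2 : ℝ) / (lam * ε) ^ ((1 : ℝ) / d)) *
        ∫ y' : Fin (m - 1) → ℝ,
          |g y'| * ((⨆ t ∈ {t : ℝ | (y', t) ∈ A}, |h (y', t)|) +
            ∫ t in {t : ℝ | (y', t) ∈ A}, |h' (y', t)|) := by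
    refine mul_nonneg hC (integral_nonneg fun y' => mul_nonneg (abs_nonneg _)
      (add_nonneg (hsup0 y') (integral_nonneg fun t => abs_nonneg _)))
  by_cases hint : IntegrableOn (fun p : (Fin (m - 1) → ℝ) × ℝ => (g p.1 : ℂ) * (h p : ℂ) *
      Complex.exp (Complex.I * (lam : ℂ) * (Φ 0 p : ℂ))) A
  swap
  · rw [integral_undef hint, norm_zero]
    exact hRHS
  rw [← integral_indicator hAmeas]
  rw [← integrable_indicator_iff hAmeas] at hint
  rw [Measure.volume_eq_prod] at hint ⊢
  rw [integral_prod _ hint, ← integral_const_mul]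
  refine norm_integral_le_of_norm_le (houter.const_mul _) (Eventually.of_forall fun y' => ?_)
  have hSo := (hAfib y').1
  have hSc := (hAfib y').2
  have hind : ∀ t, A.indicator (fun p : (Fin (m - 1) → ℝ) × ℝ => (g p.1 : ℂ) * (h p : ℂ) *
      Complex.exp (Complex.I * (lam : ℂ) * (Φ 0 p : ℂ))) (y', t) =
      {t : ℝ | (y', t) ∈ A}.indicator (fun t => (g y' : ℂ) * ((h (y', t) : ℂ) *
      Complex.exp (Complex.I * ((lam * Φ 0 (y', t) : ℝ) : ℂ)))) t := by
    intro t
    by_cases ht : (y', t) ∈ A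
    · rw [indicator_of_mem ht, indicator_of_mem (show t ∈ {t : ℝ | (y', t) ∈ A} from ht)]
      push_cast
      simp only [mul_assoc]
    · rw [indicator_of_notMem ht, indicator_of_notMem (show t ∉ {t : ℝ | (y', t) ∈ A} from ht)]
  simp_rw [hind]
  rw [integral_indicator hSo.measurableSet, integral_const_mul, norm_mul, Complex.norm_real,
    Real.norm_eq_abs]
  have := vdc_fiber hSo hSc d hd hμ (hhderiv y') (hhint y') (hsup0 y') (hsup y') (hh'int y')
    (fun k t => lam * Φ k (y', t)) (fun k hk t ht => (hΦ y' k hk t ht).const_mul lam)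
    (fun t ht => ?_) (fun h1 => ?_)
  · calc _ ≤ |g y'| * _ := mul_le_mul_of_nonneg_left this (abs_nonneg _)
      _ = _ := by ring
  · rw [abs_mul, abs_of_pos hlam]
    exact mul_le_mul_of_nonneg_left (hΦε _ ht) hlam.le
  · obtain ⟨⟨φ'', h2⟩, h3⟩ := hd1 h1 y'
    refine ⟨⟨fun t => lam * φ'' t, fun t ht => (h2 t ht).const_mul lam⟩, ?_⟩
    refine h3.imp (fun h3 => ?_) (fun h3 => ?_)
    · exact fun x hx y hy hxy => mul_le_mul_of_nonneg_left (h3 hx hy hxy) hlam.le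
    · exact fun x hx y hy hxy => mul_le_mul_of_nonneg_left (h3 hx hy hxy) hlam.le
end
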